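/- arXiv:1502.02413 — 3 statements merged into one kernel-verified Lean document; each statement's English description precedes it below -/
import Mathlib

section
/- Let G be a countable amenable group and S ⊆ G. For every Følner sequence (F_n) in G, the sequence D̲_{F_n}(S) converges and its limit equals sup{D̲_F(S) : F ⊆ G finite nonempty}; likewise the sequence D̄_{F_n}(S) converges and its limit equals inf{D̄_F(S) : F ⊆ G finite nonempty}; moreover sup{D̲_F(S) : F finite nonempty} ≤ inf{D̄_F(S) : F finite nonempty}. In particular, the lower and upper Banach densities of S do not depend on the choice of the Følner sequence. -/
open scoped Pointwise symmDiff Classical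
open Filter

namespace AmenableTilings

variable {G : Type*}

/-- The left translate `gF` of a finite set `F`. -/
noncomputable def lMul [Group G] (g : G) (F : Finset G) : Finset G := F.image (fun h => g * h)

/-- The right translate `Fg` of a finite set `F`. -/
noncomputable def rMul [Group G] (F : Finset G) (g : G) : Finset G := F.image (fun h => h * g)

/-- A Følner sequence: a sequence of finite nonempty sets with `|gFₙ Δ Fₙ|/|Fₙ| → 0`
for every `g`. -/
def IsFolnerSeq [Group G] (F : ℕ → Finset G) : Prop :=
  (∀ n, (F n).Nonempty) ∧
  ∀ g : G, Tendsto (fun n => (((lMul g (F n)) ∆ (F n)).card : ℝ) / ((F n).card : ℝ))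
    atTop (nhds 0)

/-- A group is amenable if it admits a Følner sequence. -/
def IsAmenable (G : Type*) [Group G] : Prop := ∃ F : ℕ → Finset G, IsFolnerSeq F

/-- `(K,ε)`-invariance: `|KT Δ T| < ε|T|`, where `KT = {gh : g ∈ K, h ∈ T}`. -/
def KInvariant [Group G] (K T : Finset G) (ε : ℝ) : Prop :=
  (((K * T) ∆ T).card : ℝ) < ε * (T.card : ℝ)

/-- `|S ∩ Fg|`. -/
noncomputable def interCard [Group G] (S : Set G) (F : Finset G) (g : G) : ℕ :=
  ((rMul F g).filter (fun h => h ∈ S)).card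

/-- `D̲_F(S) = inf_g |S ∩ Fg| / |F|`. -/
noncomputable def lowerD [Group G] (S : Set G) (F : Finset G) : ℝ :=
  ⨅ g : G, (interCard S F g : ℝ) / (F.card : ℝ)

/-- `D̄_F(S) = sup_g |S ∩ Fg| / |F|`. -/
noncomputable def upperD [Group G] (S : Set G) (F : Finset G) : ℝ :=
  ⨆ g : G, (interCard S F g : ℝ) / (F.card : ℝ)

/-- Lower Banach density: `sup { D̲_F(S) : F finite nonempty }`. -/
noncomputable def lowerBD [Group G] (S : Set G) : ℝ :=
  sSup {r : ℝ | ∃ F : Finset G, F.Nonempty ∧ r = lowerD S F}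

/-- Upper Banach density: `inf { D̄_F(S) : F finite nonempty }`. -/
noncomputable def upperBD [Group G] (S : Set G) : ℝ :=
  sInf {r : ℝ | ∃ F : Finset G, F.Nonempty ∧ r = upperD S F}

/-- The shift action of `G` on `Λ^G`: `(gx)(h) = x(hg)`. -/
def shift [Group G] {Λ : Type*} (g : G) (x : G → Λ) : G → Λ := fun h => x (h * g)

/-- The orbit closure of `x ∈ Λ^G` under the shift action (with `Λ` discrete and
`Λ^G` carrying the product topology). -/
noncomputable def orbitClosure [Group G] {Λ : Type*} (x : G → Λ) : Set (G → Λ) :=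
  @closure _ (@Pi.topologicalSpace G (fun _ => Λ) (fun _ => ⊥)) {y | ∃ g : G, y = shift g x}

/-- `N_X(F)`: the number of blocks with domain `F` occurring in `X`. -/
noncomputable def complexity [Group G] {Λ : Type*} (X : Set (G → Λ)) (F : Finset G) : ℕ :=
  Set.ncard ((fun x (f : {a // a ∈ F}) => x f.1) '' X)

/-- Topological entropy of a symbolic system:
`inf { (1/|F|) log₂ N_X(F) : F finite nonempty }`. -/
noncomputable def entropyOf [Group G] {Λ : Type*} (X : Set (G → Λ)) : ℝ :=
  sInf {r : ℝ | ∃ F : Finset G, F.Nonempty ∧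
    r = Real.logb 2 (complexity X F) / (F.card : ℝ)}

/-- The entropy of (the shift-orbit closure of) a symbolic element. -/
noncomputable def pointEntropy [Group G] {Λ : Type*} (x : G → Λ) : ℝ :=
  entropyOf (orbitClosure x)

/-- A quasitiling of `G`: finitely many finite shapes containing the identity,
with pairwise disjoint center sets, such that the map `(S,c) ↦ Sc` is injective. -/
structure Quasitiling (G : Type*) [Group G] where
  shapes : Finset (Finset G)
  centers : Finset G → Set G
  one_mem : ∀ S ∈ shapes, (1 : G) ∈ S
  centers_empty : ∀ S, S ∉ shapes → centers S = ∅
  centers_disjoint : ∀ S ∈ shapes, ∀ S' ∈ shapes, S ≠ S' → Disjoint (centers S) (centers S')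
  tiles_inj : ∀ S ∈ shapes, ∀ S' ∈ shapes, ∀ c ∈ centers S, ∀ c' ∈ centers S',
    rMul S c = rMul S' c' → S = S' ∧ c = c'

namespace Quasitiling

variable [Group G]

/-- `(S,c)` is a tile of the quasitiling. -/
def IsTile (𝒯 : Quasitiling G) (S : Finset G) (c : G) : Prop :=
  S ∈ 𝒯.shapes ∧ c ∈ 𝒯.centers S

/-- The union of all tiles of the quasitiling. -/
def union (𝒯 : Quasitiling G) : Set G :=
  ⋃ S ∈ 𝒯.shapes, ⋃ c ∈ 𝒯.centers S, (↑(rMul S c) : Set G)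

/-- `f` witnesses `ε`-disjointness: it assigns to each tile a `(1-ε)`-subset, and the
assigned subsets of distinct tiles are pairwise disjoint. -/
def EpsDisjointWith (𝒯 : Quasitiling G) (ε : ℝ) (f : Finset G → G → Finset G) : Prop :=
  (∀ S c, 𝒯.IsTile S c →
    f S c ⊆ rMul S c ∧ (1 - ε) * (S.card : ℝ) ≤ ((f S c).card : ℝ)) ∧
  (∀ S c S' c', 𝒯.IsTile S c → 𝒯.IsTile S' c' → (S, c) ≠ (S', c') →
    Disjoint (f S c) (f S' c'))

/-- `ε`-disjointness of a quasitiling. -/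
def EpsDisjoint (𝒯 : Quasitiling G) (ε : ℝ) : Prop := ∃ f, 𝒯.EpsDisjointWith ε f

/-- The tiles are pairwise disjoint. -/
def TilesDisjoint (𝒯 : Quasitiling G) : Prop :=
  ∀ S c S' c', 𝒯.IsTile S c → 𝒯.IsTile S' c' → (S, c) ≠ (S', c') →
    Disjoint (rMul S c) (rMul S' c')

/-- `α`-covering: the union of the tiles has lower Banach density at least `α`. -/
def Covering (𝒯 : Quasitiling G) (α : ℝ) : Prop := α ≤ lowerBD 𝒯.union

/-- An exact tiling: the tiles form a partition of `G`. -/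
def IsExactTiling (𝒯 : Quasitiling G) : Prop := 𝒯.TilesDisjoint ∧ 𝒯.union = Set.univ

/-- The symbolic representation `x_𝒯` of a quasitiling, over the alphabet
`𝒮(𝒯) ∪ {0}` (encoded as `Option (Finset G)`, with `none` playing the role of `0`):
`x_𝒯(g) = S` iff `g ∈ C(S)`. -/
noncomputable def symb (𝒯 : Quasitiling G) : G → Option (Finset G) :=
  fun g => if h : ∃ S, S ∈ 𝒯.shapes ∧ g ∈ 𝒯.centers S then some h.choose else none

/-- The entropy of a quasitiling: the topological entropy of the shift-orbit closure of
its symbolic representation. -/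
noncomputable def entropy (𝒯 : Quasitiling G) : ℝ := pointEntropy 𝒯.symb

end Quasitiling

/-- `𝒯'` is congruent with `𝒯` (each tile of `𝒯'` is a union of tiles of `𝒯`). -/
def Congruent [Group G] (𝒯 𝒯' : Quasitiling G) : Prop :=
  ∀ S c, 𝒯'.IsTile S c → ∃ P : Set (Finset G × G),
    (∀ p ∈ P, 𝒯.IsTile p.1 p.2) ∧
    (↑(rMul S c) : Set G) = ⋃ p ∈ P, (↑(rMul p.1 p.2) : Set G)

/-- The union over all tiles `(S,c)` of the assigned subsets `f S c`. -/
def subUnion [Group G] (𝒯 : Quasitiling G) (f : Finset G → G → Finset G) : Set G :=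
  ⋃ S ∈ 𝒯.shapes, ⋃ c ∈ 𝒯.centers S, (↑(f S c) : Set G)

end AmenableTilings
namespace AmenableTilings

section BanachDensity

variable {G : Type*} [Group G]

lemma interCard_eq_sum (S : Set G) (F : Finset G) (g : G) :
    (interCard S F g : ℝ) = ∑ f ∈ F, if f * g ∈ S then (1 : ℝ) else 0 := by
  unfold interCard rMul
  rw [Finset.card_filter, Finset.sum_image (fun a _ b _ h => mul_right_cancel h)]
  push_cast
  rfl

lemma interCard_le_card (S : Set G) (F : Finset G) (g : G) : interCard S F g ≤ F.card :=
  (Finset.card_filter_le _ _).trans Finset.card_image_le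

lemma interCard_div_card_nonneg (S : Set G) (F : Finset G) (g : G) :
    0 ≤ (interCard S F g : ℝ) / (F.card : ℝ) := by positivity

lemma interCard_div_card_le_one (S : Set G) (F : Finset G) (g : G) :
    (interCard S F g : ℝ) / (F.card : ℝ) ≤ 1 :=
  div_le_one_of_le₀ (by exact_mod_cast interCard_le_card S F g) (by positivity)

lemma bddBelow_interCard_div (S : Set G) (F : Finset G) :
    BddBelow (Set.range fun g : G => (interCard S F g : ℝ) / (F.card : ℝ)) :=
  ⟨0, by rintro _ ⟨g, rfl⟩; exact interCard_div_card_nonneg S F g⟩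

lemma bddAbove_interCard_div (S : Set G) (F : Finset G) :
    BddAbove (Set.range fun g : G => (interCard S F g : ℝ) / (F.card : ℝ)) :=
  ⟨1, by rintro _ ⟨g, rfl⟩; exact interCard_div_card_le_one S F g⟩

lemma lowerD_le_interCard_div (S : Set G) (F : Finset G) (g : G) :
    lowerD S F ≤ (interCard S F g : ℝ) / (F.card : ℝ) :=
  ciInf_le (bddBelow_interCard_div S F) g

lemma interCard_div_le_upperD (S : Set G) (F : Finset G) (g : G) :
    (interCard S F g : ℝ) / (F.card : ℝ) ≤ upperD S F :=
  le_ciSup (bddAbove_interCard_div S F) g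

lemma lowerD_le_upperD (S : Set G) (F : Finset G) : lowerD S F ≤ upperD S F :=
  (lowerD_le_interCard_div S F 1).trans (interCard_div_le_upperD S F 1)

lemma lowerD_le_lowerBD (S : Set G) {F : Finset G} (hF : F.Nonempty) :
    lowerD S F ≤ lowerBD S := by
  refine le_csSup ⟨1, ?_⟩ ⟨F, hF, rfl⟩
  rintro _ ⟨E, _, rfl⟩
  exact (lowerD_le_interCard_div S E 1).trans (interCard_div_card_le_one S E 1)

lemma upperBD_le_upperD (S : Set G) {F : Finset G} (hF : F.Nonempty) :
    upperBD S ≤ upperD S F := by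
  refine csInf_le ⟨0, ?_⟩ ⟨F, hF, rfl⟩
  rintro _ ⟨E, _, rfl⟩
  exact (interCard_div_card_nonneg S E 1).trans (interCard_div_le_upperD S E 1)

lemma abs_sum_sub_sum_le_card_symmDiff {α : Type*} (A B : Finset α) (u : α → ℝ)
    (hu : ∀ a, |u a| ≤ 1) : |∑ a ∈ A, u a - ∑ a ∈ B, u a| ≤ ((A ∆ B).card : ℝ) := by
  have hsub : ∑ a ∈ A, u a - ∑ a ∈ B, u a = ∑ a ∈ A \ B, u a - ∑ a ∈ B \ A, u a :=
    (Finset.sum_sdiff_sub_sum_sdiff).symm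
  have hbound : ∀ E : Finset α, |∑ a ∈ E, u a| ≤ (E.card : ℝ) := fun E =>
    (Finset.abs_sum_le_sum_abs _ _).trans
      ((Finset.sum_le_sum fun a _ => hu a).trans (by simp))
  have hcard : ((A ∆ B).card : ℝ) = (A \ B).card + (B \ A).card := by
    rw [symmDiff_def, Finset.sup_eq_union, Finset.card_union_of_disjoint disjoint_sdiff_sdiff]
    push_cast
    rfl
  rw [hsub, hcard]
  exact (abs_sub _ _).trans (add_le_add (hbound _) (hbound _))

/-- The average over `f ∈ E` of the relative boundary `|fF Δ F| / |F|`. -/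
noncomputable def meanBoundary (E F : Finset G) : ℝ :=
  (∑ f ∈ E, ((lMul f F ∆ F).card : ℝ) / (F.card : ℝ)) / (E.card : ℝ)

lemma IsFolnerSeq.tendsto_meanBoundary {F : ℕ → Finset G} (hF : IsFolnerSeq F)
    (E : Finset G) : Tendsto (fun n => meanBoundary E (F n)) atTop (nhds 0) := by
  have h := (tendsto_finsetSum E fun f _ => hF.2 f).div_const (E.card : ℝ)
  simpa [meanBoundary] using h

/-- Double counting of the pairs `(f, t) ∈ E × F` with `f * t * g ∈ S`. -/
lemma abs_sum_interCard_sub_le (S : Set G) (E F : Finset G) (g : G) :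
    |∑ t ∈ F, (interCard S E (t * g) : ℝ) - (E.card : ℝ) * interCard S F g| ≤
      ∑ f ∈ E, ((lMul f F ∆ F).card : ℝ) := by
  let u : G → ℝ := fun x => if x * g ∈ S then 1 else 0
  have hu : ∀ x, |u x| ≤ 1 := fun x => by
    simp only [u]
    split_ifs <;> simp
  have hswap : ∑ t ∈ F, (interCard S E (t * g) : ℝ) = ∑ f ∈ E, ∑ x ∈ lMul f F, u x := by
    simp only [interCard_eq_sum]
    rw [Finset.sum_comm]
    refine Finset.sum_congr rfl fun f _ => ?_
    rw [lMul, Finset.sum_image (fun a _ b _ h => mul_left_cancel h)]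
    simp only [u, mul_assoc]
  have hconst : (E.card : ℝ) * interCard S F g = ∑ _f ∈ E, ∑ x ∈ F, u x := by
    rw [Finset.sum_const, nsmul_eq_mul, interCard_eq_sum]
  rw [hswap, hconst, ← Finset.sum_sub_distrib]
  exact (Finset.abs_sum_le_sum_abs _ _).trans
    (Finset.sum_le_sum fun f _ => abs_sum_sub_sum_le_card_symmDiff _ _ u hu)

lemma lowerD_sub_meanBoundary_le (S : Set G) {E F : Finset G} (hE : E.Nonempty)
    (hF : F.Nonempty) : lowerD S E - meanBoundary E F ≤ lowerD S F := by
  have hE' : (0 : ℝ) < E.card := by exact_mod_cast hE.card_pos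
  have hF' : (0 : ℝ) < F.card := by exact_mod_cast hF.card_pos
  refine le_ciInf fun g => ?_
  have h := (abs_le.1 (abs_sum_interCard_sub_le S E F g)).2
  have hsum : (F.card : ℝ) * (lowerD S E * E.card) ≤
      ∑ t ∈ F, (interCard S E (t * g) : ℝ) := by
    rw [← nsmul_eq_mul]
    exact Finset.card_nsmul_le_sum _ _ _ fun t _ =>
      (le_div_iff₀ hE').1 (lowerD_le_interCard_div S E (t * g))
  rw [meanBoundary, ← Finset.sum_div, div_div, sub_le_iff_le_add,
    div_add_div _ _ hF'.ne' (mul_pos hF' hE').ne', le_div_iff₀ (by positivity)]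
  nlinarith

lemma upperD_le_add_meanBoundary (S : Set G) {E F : Finset G} (hE : E.Nonempty)
    (hF : F.Nonempty) : upperD S F ≤ upperD S E + meanBoundary E F := by
  have hE' : (0 : ℝ) < E.card := by exact_mod_cast hE.card_pos
  have hF' : (0 : ℝ) < F.card := by exact_mod_cast hF.card_pos
  refine ciSup_le fun g => ?_
  have h := (abs_le.1 (abs_sum_interCard_sub_le S E F g)).1
  have hsum : ∑ t ∈ F, (interCard S E (t * g) : ℝ) ≤
      (F.card : ℝ) * (upperD S E * E.card) := by
    rw [← nsmul_eq_mul]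
    exact Finset.sum_le_card_nsmul _ _ _ fun t _ =>
      (div_le_iff₀ hE').1 (interCard_div_le_upperD S E (t * g))
  rw [meanBoundary, ← Finset.sum_div, div_div, ← sub_le_iff_le_add',
    div_sub' hF'.ne', div_le_div_iff₀ hF' (mul_pos hF' hE')]
  nlinarith

lemma IsFolnerSeq.tendsto_lowerD {F : ℕ → Finset G} (hF : IsFolnerSeq F) (S : Set G) :
    Tendsto (fun n => lowerD S (F n)) atTop (nhds (lowerBD S)) := by
  refine tendsto_order.2 ⟨fun a ha => ?_, fun a ha =>
    Eventually.of_forall fun n => (lowerD_le_lowerBD S (hF.1 n)).trans_lt ha⟩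
  obtain ⟨_, ⟨E, hE, rfl⟩, haE⟩ := exists_lt_of_lt_csSup
    (s := {r : ℝ | ∃ F : Finset G, F.Nonempty ∧ r = lowerD S F})
    ⟨_, F 0, hF.1 0, rfl⟩ ha
  filter_upwards [(hF.tendsto_meanBoundary E).eventually_lt_const (sub_pos.2 haE)] with n hn
  linarith [lowerD_sub_meanBoundary_le S hE (hF.1 n)]

lemma IsFolnerSeq.tendsto_upperD {F : ℕ → Finset G} (hF : IsFolnerSeq F) (S : Set G) :
    Tendsto (fun n => upperD S (F n)) atTop (nhds (upperBD S)) := by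
  refine tendsto_order.2 ⟨fun a ha => Eventually.of_forall fun n =>
    ha.trans_le (upperBD_le_upperD S (hF.1 n)), fun a ha => ?_⟩
  obtain ⟨_, ⟨E, hE, rfl⟩, haE⟩ := exists_lt_of_csInf_lt
    (s := {r : ℝ | ∃ F : Finset G, F.Nonempty ∧ r = upperD S F})
    ⟨_, F 0, hF.1 0, rfl⟩ ha
  filter_upwards [(hF.tendsto_meanBoundary E).eventually_lt_const (sub_pos.2 haE)] with n hn
  linarith [upperD_le_add_meanBoundary S hE (hF.1 n)]

end BanachDensity

/-- for any Følner sequence, `D̲_{Fₙ}(S)` converges to the lower Banach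
density (the sup over finite sets), `D̄_{Fₙ}(S)` converges to the upper Banach density
(the inf over finite sets), and the lower density does not exceed the upper one.
In particular the Banach densities do not depend on the Følner sequence. -/
theorem statement3 {G : Type*} [Group G] [Countable G] (hG : IsAmenable G) (S : Set G) :
    (∀ F : ℕ → Finset G, IsFolnerSeq F →
        Filter.Tendsto (fun n => lowerD S (F n)) Filter.atTop (nhds (lowerBD S)) ∧
        Filter.Tendsto (fun n => upperD S (F n)) Filter.atTop (nhds (upperBD S))) ∧
    lowerBD S ≤ upperBD S := by
  refine ⟨fun F hF => ⟨hF.tendsto_lowerD S, hF.tendsto_upperD S⟩, ?_⟩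
  obtain ⟨F, hF⟩ := hG
  exact le_of_tendsto_of_tendsto' (hF.tendsto_lowerD S) (hF.tendsto_upperD S)
    fun n => lowerD_le_upperD S (F n)

end AmenableTilings
end

section
/- Let G be a countable amenable group, Λ a finite alphabet, and X ⊆ Λ^G a subshift. Then for every Følner sequence (F_n) in G, the sequence (1/|F_n|) log₂ N_X(F_n) converges, and its limit (the topological entropy of X) equals inf{(1/|F|) log₂ N_X(F) : F ⊆ G finite nonempty}. -/
open scoped Pointwise symmDiff Classical
open Filter

namespace AmenableTilings

/-- Hölder's inequality for a finite sum of products of finitely many functions. -/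
theorem sum_prod_rpow_le_prod_sum_rpow {α ι : Type*} [Fintype α] (s : Finset ι) (f : ι → α → ENNReal)
    {p : ι → ℝ} (hp : ∑ i ∈ s, p i = 1) (h2p : ∀ i ∈ s, 0 ≤ p i) :
    ∑ a, ∏ i ∈ s, f i a ^ p i ≤ ∏ i ∈ s, (∑ a, f i a) ^ p i := by
  let _ : MeasurableSpace α := ⊤
  have := ENNReal.lintegral_prod_norm_pow_le (μ := MeasureTheory.Measure.count) s
    (f := f) (fun i _ => measurable_from_top.aemeasurable) hp h2p
  simpa [MeasureTheory.lintegral_count, tsum_fintype] using this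

section Complexity

variable {G : Type*} [Group G] {Λ : Type*}

theorem logb_complexity_nonneg (X : Set (G → Λ)) (F : Finset G) :
    0 ≤ Real.logb 2 (complexity X F) :=
  div_nonneg (Real.log_natCast_nonneg _) (Real.log_nonneg (by norm_num))

variable [Fintype Λ]

theorem complexity_mono {X Y : Set (G → Λ)} (h : X ⊆ Y) (F : Finset G) :
    complexity X F ≤ complexity Y F :=
  Set.ncard_le_ncard (Set.image_mono h) (Set.toFinite _)

theorem complexity_pos {X : Set (G → Λ)} (hX : X.Nonempty) (F : Finset G) :
    0 < complexity X F :=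
  (Set.ncard_pos (Set.toFinite _)).2 (hX.image _)

theorem complexity_le_pow (X : Set (G → Λ)) (F : Finset G) :
    complexity X F ≤ Fintype.card Λ ^ F.card := by
  refine (Set.ncard_le_ncard (Set.subset_univ _) (Set.toFinite _)).trans ?_
  simp [Set.ncard_univ, Nat.card_eq_fintype_card]

/-- Patterns on `insert w F` are classified by their symbol at `w`. -/
theorem complexity_insert (X : Set (G → Λ)) (w : G) (F : Finset G) :
    complexity X (insert w F) = ∑ a : Λ, complexity {x ∈ X | x w = a} F := by
  let w' : {a // a ∈ insert w F} := ⟨w, Finset.mem_insert_self w F⟩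
  set P := (fun x (f : {a // a ∈ insert w F}) => x f.1) '' X with hP
  have hfib : ∀ a : Λ, complexity {x ∈ X | x w = a} F = (P.toFinset.filter (· w' = a)).card := by
    intro a
    let r : ({a // a ∈ insert w F} → Λ) → ({a // a ∈ F} → Λ) :=
      fun p f => p ⟨f.1, Finset.mem_insert_of_mem f.2⟩
    have himg : (fun x (f : {a // a ∈ F}) => x f.1) '' {x ∈ X | x w = a} =
        r '' {p ∈ P | p w' = a} := by
      ext q
      constructor
      · rintro ⟨x, ⟨hx, hxa⟩, rfl⟩
        exact ⟨_, ⟨⟨x, hx, rfl⟩, hxa⟩, rfl⟩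
      · rintro ⟨_, ⟨⟨x, hx, rfl⟩, hxa⟩, rfl⟩
        exact ⟨x, ⟨hx, hxa⟩, rfl⟩
    have hinj : Set.InjOn r {p ∈ P | p w' = a} := by
      rintro p ⟨-, hp⟩ q ⟨-, hq⟩ hpq
      ext ⟨f, hf⟩
      rcases Finset.mem_insert.1 hf with rfl | hf'
      · exact hp.trans hq.symm
      · exact congrFun hpq ⟨f, hf'⟩
    rw [complexity, himg, hinj.ncard_image, Set.ncard_eq_toFinset_card']
    congr 1
    ext p
    simp
  rw [complexity, ← hP, Set.ncard_eq_toFinset_card',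
    Finset.card_eq_sum_card_fiberwise (f := fun p => p w') (t := Finset.univ) (by simp [Set.MapsTo])]
  exact Finset.sum_congr rfl fun a _ => (hfib a).symm

/-- Shearer's inequality for pattern counts: if every point of `W` lies in exactly `k` of the
sets `S j`, then `N_X(W) ≤ ∏ N_X(S j ∩ W)^(1/k)`. -/
theorem complexity_le_prod_rpow {ι : Type*} (J : Finset ι) (S : ι → Finset G) {k : ℕ} (hk : 0 < k)
    (W : Finset G) (hW : ∀ w ∈ W, (J.filter (fun j => w ∈ S j)).card = k) (X : Set (G → Λ)) :
    (complexity X W : ENNReal) ≤ ∏ j ∈ J, (complexity X (S j ∩ W) : ENNReal) ^ (1 / k : ℝ) := by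
  have hk' : (0 : ℝ) ≤ 1 / k := by positivity
  induction W using Finset.induction_on generalizing X with
  | empty =>
    rcases X.eq_empty_or_nonempty with rfl | hX
    · simp [complexity]
    · have h1 : complexity X ∅ = 1 :=
        le_antisymm (by simpa using complexity_le_pow X ∅) (complexity_pos hX ∅)
      simp [h1]
  | insert w W _ ih =>
    have ih := ih fun v hv => hW v (Finset.mem_insert_of_mem hv)
    rw [complexity_insert, ← Finset.prod_filter_mul_prod_filter_not J (fun j => w ∈ S j)]
    push_cast
    calc ∑ a, (complexity {x ∈ X | x w = a} W : ENNReal)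
        ≤ ∑ a, (∏ j ∈ J with w ∈ S j,
              (complexity {x ∈ X | x w = a} (S j ∩ W) : ENNReal) ^ (1 / k : ℝ)) *
            ∏ j ∈ J with w ∉ S j, (complexity X (S j ∩ insert w W) : ENNReal) ^ (1 / k : ℝ) := by
          refine Finset.sum_le_sum fun a _ => (ih _).trans ?_
          rw [← Finset.prod_filter_mul_prod_filter_not J (fun j => w ∈ S j)]
          refine mul_le_mul_right (Finset.prod_le_prod' fun j hj => ?_) _
          rw [Finset.inter_insert_of_notMem (Finset.mem_filter.1 hj).2]
          exact ENNReal.rpow_le_rpow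
            (by exact_mod_cast complexity_mono (Set.sep_subset _ _) _) hk'
      _ ≤ _ := by
          rw [← Finset.sum_mul]
          refine mul_le_mul_left ?_ _
          refine (sum_prod_rpow_le_prod_sum_rpow _ _ ?_ fun _ _ => hk').trans
            (Finset.prod_le_prod' fun j hj => ?_)
          · rw [Finset.sum_const, hW w (Finset.mem_insert_self w W), nsmul_eq_mul]
            field_simp
          · rw [Finset.inter_insert_of_mem (Finset.mem_filter.1 hj).2, complexity_insert]
            push_cast
            exact le_rfl

theorem complexity_pow_le_prod {ι : Type*} (J : Finset ι) (S : ι → Finset G) {k : ℕ} (hk : 0 < k)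
    (W : Finset G) (hW : ∀ w ∈ W, (J.filter (fun j => w ∈ S j)).card = k) (X : Set (G → Λ)) :
    complexity X W ^ k ≤ ∏ j ∈ J, complexity X (S j ∩ W) := by
  have h := pow_le_pow_left' (complexity_le_prod_rpow J S hk W hW X) k
  rw [← Finset.prod_pow] at h
  have hk' : (k : ℝ) ≠ 0 := by positivity
  simp only [← ENNReal.rpow_natCast, ← ENNReal.rpow_mul, one_div, inv_mul_cancel₀ hk',
    ENNReal.rpow_one] at h
  rw [ENNReal.rpow_natCast] at h
  exact_mod_cast h

theorem complexity_rMul_le {X : Set (G → Λ)} (hinv : ∀ g : G, ∀ x ∈ X, shift g x ∈ X)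
    (K : Finset G) (g : G) : complexity X (rMul K g) ≤ complexity X K := by
  let r : ({a // a ∈ K} → Λ) → ({a // a ∈ rMul K g} → Λ) := fun p f => p ⟨f.1 * g⁻¹, by
    obtain ⟨h, hh, e⟩ := Finset.mem_image.1 f.2
    simpa [← e] using hh⟩
  refine (Set.ncard_le_ncard ?_ (Set.toFinite _)).trans (Set.ncard_image_le (f := r))
  rintro _ ⟨x, hx, rfl⟩
  refine ⟨_, ⟨shift g x, hinv g x hx, rfl⟩, ?_⟩
  ext f
  simp [r, shift]

theorem card_rMul (K : Finset G) (g : G) : (rMul K g).card = K.card :=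
  Finset.card_image_of_injective _ (mul_left_injective g)

theorem card_filter_mem_rMul (K F : Finset G) {f : G} (hf : f ∈ F) :
    ((K⁻¹ * F).filter (fun g => f ∈ rMul K g)).card = K.card := by
  have : (K⁻¹ * F).filter (fun g => f ∈ rMul K g) = K.image (fun k => k⁻¹ * f) := by
    ext g
    simp only [rMul, Finset.mem_filter, Finset.mem_image]
    constructor
    · rintro ⟨-, k, hk, rfl⟩
      exact ⟨k, hk, by group⟩
    · rintro ⟨k, hk, rfl⟩
      exact ⟨Finset.mul_mem_mul (Finset.inv_mem_inv hk) hf, k, hk, by group⟩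
  rw [this]
  exact Finset.card_image_of_injective _ fun a b h => inv_injective (mul_right_cancel h)

/-- The translates of `K` that meet `F` without being contained in it are few when `F` is almost
invariant. -/
theorem card_filter_not_rMul_subset_le (K F : Finset G) :
    ((K⁻¹ * F).filter (fun g => ¬ rMul K g ⊆ F)).card ≤
      ∑ p ∈ K ×ˢ K, ((lMul (p.1 * p.2⁻¹) F) ∆ F).card := by
  have hsub : (K⁻¹ * F).filter (fun g => ¬ rMul K g ⊆ F) ⊆
      (K ×ˢ K).biUnion fun p => ((lMul (p.1 * p.2⁻¹) F) ∆ F).image (fun h => p.1⁻¹ * h) := by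
    intro g hg
    obtain ⟨hg, hgF⟩ := Finset.mem_filter.1 hg
    obtain ⟨k', hk', f, hf, rfl⟩ := Finset.mem_mul.1 hg
    obtain ⟨h, hh, hhF⟩ := Finset.not_subset.1 hgF
    obtain ⟨k, hk, rfl⟩ := Finset.mem_image.1 hh
    refine Finset.mem_biUnion.2 ⟨(k, k'⁻¹), Finset.mk_mem_product hk (Finset.mem_inv'.1 hk'),
      Finset.mem_image.2 ⟨_, Finset.mem_symmDiff.2 (Or.inl ⟨?_, hhF⟩), by group⟩⟩
    exact Finset.mem_image.2 ⟨f, hf, by group⟩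
  exact (Finset.card_le_card hsub).trans
    (Finset.card_biUnion_le.trans (Finset.sum_le_sum fun p _ => Finset.card_image_le))

theorem card_filter_rMul_subset_le {K : Finset G} (hK : K.Nonempty) (J F : Finset G) :
    (J.filter (fun g => rMul K g ⊆ F)).card ≤ F.card := by
  obtain ⟨k, hk⟩ := hK
  exact Finset.card_le_card_of_injOn (fun g => k * g)
    (fun g hg => (Finset.mem_filter.1 hg).2 (Finset.mem_image.2 ⟨k, hk, rfl⟩))
    (mul_right_injective k).injOn

theorem logb_complexity_le {X : Set (G → Λ)} (hX : X.Nonempty)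
    (hinv : ∀ g : G, ∀ x ∈ X, shift g x ∈ X) {K : Finset G} (hK : K.Nonempty) (F : Finset G) :
    K.card * Real.logb 2 (complexity X F) ≤ F.card * Real.logb 2 (complexity X K) +
      (∑ p ∈ K ×ˢ K, ((lMul (p.1 * p.2⁻¹) F) ∆ F).card : ℕ) *
        (K.card * Real.logb 2 (Fintype.card Λ)) := by
  have hΛ : 0 < Fintype.card Λ := by
    obtain ⟨x, -⟩ := hX
    exact Fintype.card_pos_iff.2 ⟨x 1⟩
  have hpos : ∀ F : Finset G, (0 : ℝ) < complexity X F := fun F =>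
    Nat.cast_pos.2 (complexity_pos hX F)
  have hprod : (complexity X F : ℝ) ^ K.card ≤
      ∏ g ∈ K⁻¹ * F, (complexity X (rMul K g ∩ F) : ℝ) := by
    exact_mod_cast complexity_pow_le_prod (K⁻¹ * F) (rMul K) hK.card_pos F
      (fun f hf => card_filter_mem_rMul K F hf) X
  have hlog := Real.logb_le_logb_of_le (b := 2) (by norm_num) (pow_pos (hpos F) _) hprod
  rw [Real.logb_pow, Real.logb_prod _ _ fun g _ => (hpos _).ne',
    ← Finset.sum_filter_add_sum_filter_not (K⁻¹ * F) (fun g => rMul K g ⊆ F)] at hlog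
  refine hlog.trans (add_le_add ?_ ?_)
  · refine (Finset.sum_le_card_nsmul _ _ (Real.logb 2 (complexity X K)) fun g hg => ?_).trans ?_
    · rw [Finset.inter_eq_left.2 (Finset.mem_filter.1 hg).2]
      exact Real.logb_le_logb_of_le (by norm_num) (hpos _)
        (by exact_mod_cast complexity_rMul_le hinv K g)
    · rw [nsmul_eq_mul]
      exact mul_le_mul_of_nonneg_right
        (by exact_mod_cast card_filter_rMul_subset_le hK _ F) (logb_complexity_nonneg X K)
  · refine (Finset.sum_le_card_nsmul _ _ (K.card * Real.logb 2 (Fintype.card Λ))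
      fun g _ => ?_).trans ?_
    · rw [← Real.logb_pow]
      refine Real.logb_le_logb_of_le (by norm_num) (hpos _) ?_
      refine le_trans (Nat.cast_le.2 (complexity_le_pow X _)) ?_
      push_cast
      refine pow_le_pow_right₀ (by exact_mod_cast hΛ) ?_
      exact (Finset.card_le_card Finset.inter_subset_left).trans (card_rMul K g).le
    · rw [nsmul_eq_mul]
      refine mul_le_mul_of_nonneg_right
        (by exact_mod_cast card_filter_not_rMul_subset_le K F) (mul_nonneg (by positivity) ?_)
      exact Real.logb_nonneg (by norm_num) (by exact_mod_cast hΛ)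

end Complexity

/-- for a subshift `X` over a finite alphabet and any Følner sequence,
`(1/|Fₙ|) log₂ N_X(Fₙ)` converges, with limit equal to
`inf { (1/|F|) log₂ N_X(F) : F finite nonempty }` (the topological entropy of `X`). -/
theorem statement5 {G : Type*} [Group G] [Countable G]
    {Λ : Type*} [Fintype Λ] [TopologicalSpace Λ] [DiscreteTopology Λ]
    (X : Set (G → Λ)) (hne : X.Nonempty) (hclosed : IsClosed X)
    (hinv : ∀ g : G, ∀ x ∈ X, shift g x ∈ X)
    (F : ℕ → Finset G) (hF : IsFolnerSeq F) :
    Filter.Tendsto (fun n => Real.logb 2 (complexity X (F n)) / ((F n).card : ℝ))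
      Filter.atTop (nhds (entropyOf X)) := by
  have hbdd : BddBelow {r : ℝ | ∃ F : Finset G, F.Nonempty ∧
      r = Real.logb 2 (complexity X F) / (F.card : ℝ)} := by
    refine ⟨0, ?_⟩
    rintro _ ⟨F, -, rfl⟩
    exact div_nonneg (logb_complexity_nonneg X F) (Nat.cast_nonneg _)
  refine tendsto_order.2 ⟨fun a ha => Eventually.of_forall fun n =>
    ha.trans_le (csInf_le hbdd ⟨F n, hF.1 n, rfl⟩), fun b hb => ?_⟩
  obtain ⟨_, ⟨K, hK, rfl⟩, hKb⟩ := exists_lt_of_csInf_lt (by exact ⟨_, F 0, hF.1 0, rfl⟩) hb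
  have hlim : Tendsto (fun n => Real.logb 2 (complexity X K) / (K.card : ℝ) +
      (∑ p ∈ K ×ˢ K, (((lMul (p.1 * p.2⁻¹) (F n)) ∆ (F n)).card : ℝ) / ((F n).card : ℝ)) *
        Real.logb 2 (Fintype.card Λ)) atTop (nhds (Real.logb 2 (complexity X K) / K.card)) := by
    have h := (tendsto_finsetSum (K ×ˢ K) fun p _ => hF.2 (p.1 * p.2⁻¹)).mul_const
      (Real.logb 2 (Fintype.card Λ))
    simpa using h.const_add (Real.logb 2 (complexity X K) / K.card)
  filter_upwards [hlim.eventually_lt_const hKb] with n hn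
  refine lt_of_le_of_lt ?_ hn
  have hFn : (0 : ℝ) < (F n).card := Nat.cast_pos.2 (hF.1 n).card_pos
  have hKc : (0 : ℝ) < K.card := Nat.cast_pos.2 hK.card_pos
  have h := logb_complexity_le hne hinv hK (F n)
  push_cast at h
  rw [← Finset.sum_div, div_le_iff₀ hFn]
  refine le_of_mul_le_mul_left (h.trans_eq ?_) hKc
  field_simp

end AmenableTilings
end

section
/- Let G be a countable amenable group. For every positive integer r and every ε > 0 there exists δ = δ(r,ε) > 0 for which the following holds: if 𝒯 is a (1/4)-disjoint quasitiling of G whose collection of shapes 𝒮(𝒯) can be partitioned into r disjoint classes 𝒮_1, …, 𝒮_r such that for each i = 1, …, r one has s_i = min{|S| : S ∈ 𝒮_i} ≥ 1/δ and |𝒮_i| ≤ 2^{ε s_i}, then the entropy of 𝒯 satisfies h(𝒯) < 3ε. -/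
open scoped Pointwise symmDiff Classical
open Filter

namespace AmenableTilings

/-- Chernoff-type count of the words over a finite alphabet with total weight at most `B`. -/
theorem card_words_weight_le {ι α : Type*} [Fintype ι] [DecidableEq ι] (A : Finset α)
    (w : α → ℝ) (B : ℝ) :
    (((Fintype.piFinset fun _ : ι => A).filter fun p => ∑ i, w (p i) ≤ B).card : ℝ) ≤
      (2 : ℝ) ^ B * (∑ a ∈ A, (2 : ℝ) ^ (-w a)) ^ Fintype.card ι := by
  have hprod : (∑ a ∈ A, (2 : ℝ) ^ (-w a)) ^ Fintype.card ι =
      ∑ p ∈ Fintype.piFinset fun _ : ι => A, ∏ i, (2 : ℝ) ^ (-w (p i)) := by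
    rw [← Finset.card_univ, ← Finset.prod_const]
    exact Finset.prod_univ_sum (fun _ => A) fun _ a => (2 : ℝ) ^ (-w a)
  rw [hprod, Finset.mul_sum, Finset.cast_card]
  refine (Finset.sum_le_sum fun p hp => ?_).trans
    (Finset.sum_le_sum_of_subset_of_nonneg (Finset.filter_subset _ _) fun p _ _ => by positivity)
  rw [← Real.rpow_sum_of_pos two_pos, ← Real.rpow_add two_pos, Finset.sum_neg_distrib]
  exact Real.one_le_rpow one_le_two (by linarith [(Finset.mem_filter.mp hp).2])

/-- In an amenable group, `|KF| ≤ (1 + η)|F|` for some finite nonempty `F`. -/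
theorem IsAmenable.exists_card_mul_le {G : Type*} [Group G] (hG : IsAmenable G) (K : Finset G)
    {η : ℝ} (hη : 0 < η) :
    ∃ F : Finset G, F.Nonempty ∧ ((K * F).card : ℝ) ≤ (1 + η) * F.card := by
  obtain ⟨F, hne, hF⟩ := hG
  have hlim : Tendsto (fun n => ∑ g ∈ K, ((lMul g (F n) ∆ F n).card : ℝ) / (F n).card)
      atTop (nhds 0) := by
    simpa using tendsto_finsetSum K fun g _ => hF g
  obtain ⟨n, hn⟩ := (hlim.eventually (gt_mem_nhds hη)).exists
  refine ⟨F n, hne n, ?_⟩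
  have hpos : (0 : ℝ) < (F n).card := by exact_mod_cast (hne n).card_pos
  rw [← Finset.sum_div, div_lt_iff₀ hpos] at hn
  have hsub : K * F n ⊆ F n ∪ K.biUnion fun g => lMul g (F n) ∆ F n := by
    intro x hx
    obtain ⟨g, hg, h, hh, rfl⟩ := Finset.mem_mul.mp hx
    by_cases hgh : g * h ∈ F n
    · exact Finset.mem_union_left _ hgh
    · refine Finset.mem_union_right _ (Finset.mem_biUnion.mpr ⟨g, hg, ?_⟩)
      exact Finset.mem_symmDiff.mpr (Or.inl ⟨Finset.mem_image_of_mem _ hh, hgh⟩)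
  have hcard : (K * F n).card ≤ (F n).card + ∑ g ∈ K, (lMul g (F n) ∆ F n).card :=
    (Finset.card_le_card hsub).trans
      ((Finset.card_union_le _ _).trans (Nat.add_le_add_left Finset.card_biUnion_le _))
  have hcard' : ((K * F n).card : ℝ) ≤
      (F n).card + ∑ g ∈ K, ((lMul g (F n) ∆ F n).card : ℝ) := by exact_mod_cast hcard
  linarith

/-- Every block with finite domain of a point of the orbit closure occurs in the orbit. -/
theorem exists_shift_eq_of_mem_orbitClosure {G Λ : Type*} [Group G] {x y : G → Λ}
    (hy : y ∈ orbitClosure x) (F : Finset G) : ∃ g : G, ∀ h ∈ F, y h = x (h * g) := by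
  let _ : TopologicalSpace Λ := ⊥
  have : DiscreteTopology Λ := ⟨rfl⟩
  have hopen : IsOpen ((F : Set G).pi fun h => ({y h} : Set Λ)) :=
    isOpen_set_pi F.finite_toSet fun _ _ => isOpen_discrete _
  obtain ⟨_, hz, g, rfl⟩ := mem_closure_iff.mp hy _ hopen fun _ _ => rfl
  exact ⟨g, fun h hh => (hz h hh).symm⟩

theorem entropyOf_le {G Λ : Type*} [Group G] (X : Set (G → Λ)) {F : Finset G}
    (hF : F.Nonempty) : entropyOf X ≤ Real.logb 2 (complexity X F) / F.card := by
  refine csInf_le ⟨0, ?_⟩ ⟨F, hF, rfl⟩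
  rintro _ ⟨F, -, rfl⟩
  have : 0 ≤ Real.logb 2 (complexity X F : ℝ) :=
    div_nonneg (Real.log_natCast_nonneg _) (Real.log_nonneg one_le_two)
  positivity

namespace Quasitiling

variable {G : Type*} [Group G]

theorem isTile_of_symb_eq_some {𝒯 : Quasitiling G} {g : G} {S : Finset G}
    (h : 𝒯.symb g = some S) : 𝒯.IsTile S g := by
  unfold symb at h
  split_ifs at h with hex
  exact Option.some.inj h ▸ hex.choose_spec

/-- The size of the shape encoded by a symbol, with value `0` on the empty symbol. -/
def symbolSize (a : Option (Finset G)) : ℕ := a.elim 0 Finset.card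

theorem EpsDisjoint.sum_symbolSize_le {𝒯 : Quasitiling G} {ε : ℝ} (h𝒯 : 𝒯.EpsDisjoint ε)
    (F : Finset G) (g : G) :
    (1 - ε) * ∑ h ∈ F, (symbolSize (𝒯.symb (h * g)) : ℝ) ≤
      (𝒯.shapes.biUnion id * F).card := by
  obtain ⟨f, hf, hdisj⟩ := h𝒯
  let D : G → Finset G := fun h => (𝒯.symb (h * g)).elim ∅ fun S => f S (h * g)
  have hmem : ∀ {h x}, x ∈ D h → ∃ S, 𝒯.IsTile S (h * g) ∧ x ∈ f S (h * g) := by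
    intro h x hx
    cases hs : 𝒯.symb (h * g) with
    | none => simp [D, hs] at hx
    | some S => exact ⟨S, isTile_of_symb_eq_some hs, by simpa [D, hs] using hx⟩
  have hD : (F : Set G).PairwiseDisjoint D := by
    intro h _ h' _ hne
    refine Finset.disjoint_left.mpr fun x hx hx' => ?_
    obtain ⟨S, hS, hxS⟩ := hmem hx
    obtain ⟨S', hS', hxS'⟩ := hmem hx'
    refine Finset.disjoint_left.mp (hdisj S _ S' _ hS hS' fun heq => hne ?_) hxS hxS'
    exact mul_right_cancel (Prod.ext_iff.mp heq).2
  have hsub : F.biUnion D ⊆ rMul (𝒯.shapes.biUnion id * F) g := by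
    intro x hx
    obtain ⟨h, hh, hxh⟩ := Finset.mem_biUnion.mp hx
    obtain ⟨S, hS, hxS⟩ := hmem hxh
    obtain ⟨s, hs, rfl⟩ := Finset.mem_image.mp ((hf S _ hS).1 hxS)
    exact Finset.mem_image.mpr ⟨s * h,
      Finset.mul_mem_mul (Finset.mem_biUnion.mpr ⟨S, hS.1, hs⟩) hh, mul_assoc _ _ _⟩
  have hcard : ∑ h ∈ F, (D h).card ≤ (𝒯.shapes.biUnion id * F).card := by
    rw [← Finset.card_biUnion hD]
    exact (Finset.card_le_card hsub).trans Finset.card_image_le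
  calc (1 - ε) * ∑ h ∈ F, (symbolSize (𝒯.symb (h * g)) : ℝ)
      ≤ ∑ h ∈ F, ((D h).card : ℝ) := by
        rw [Finset.mul_sum]
        refine Finset.sum_le_sum fun h _ => ?_
        cases hs : 𝒯.symb (h * g) with
        | none => simp [D, hs, symbolSize]
        | some S => simpa [D, hs, symbolSize] using (hf S _ (isTile_of_symb_eq_some hs)).2
    _ ≤ _ := by exact_mod_cast hcard

/-- If the shape sizes have total weight `∑ 2^(-a|S|)` at most `2^b - 1`, a quasitiling that is
`ε`-disjoint has entropy at most `a(1+η)/(1-ε) + b`. -/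
theorem EpsDisjoint.entropy_le {𝒯 : Quasitiling G} {ε : ℝ} (h𝒯 : 𝒯.EpsDisjoint ε)
    (hG : IsAmenable G) (hε : ε < 1) {a b η : ℝ} (ha : 0 ≤ a) (hb : 0 ≤ b) (hη : 0 < η)
    (hsum : 1 + ∑ S ∈ 𝒯.shapes, (2 : ℝ) ^ (-(a * S.card)) ≤ 2 ^ b) :
    𝒯.entropy ≤ a * ((1 + η) / (1 - ε)) + b := by
  obtain ⟨F, hne, hF⟩ := hG.exists_card_mul_le (𝒯.shapes.biUnion id) hη
  have hpos : (0 : ℝ) < F.card := by exact_mod_cast hne.card_pos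
  have hε' : 0 < 1 - ε := by linarith
  refine (entropyOf_le _ hne).trans ((div_le_iff₀ hpos).mpr ?_)
  set B : ℝ := a * ((1 + η) / (1 - ε)) * F.card with hB
  let P : Finset ({h // h ∈ F} → Option (Finset G)) :=
    (Fintype.piFinset fun _ => Finset.insertNone 𝒯.shapes).filter
      fun p => ∑ h, a * (symbolSize (p h) : ℝ) ≤ B
  have hsub : (fun x (h : {h // h ∈ F}) => x h.1) '' orbitClosure 𝒯.symb ⊆ (P : Set _) := by
    rintro _ ⟨y, hy, rfl⟩
    obtain ⟨g, hg⟩ := exists_shift_eq_of_mem_orbitClosure hy F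
    refine Finset.mem_coe.mpr (Finset.mem_filter.mpr ⟨Fintype.mem_piFinset.mpr fun h => ?_, ?_⟩)
    · refine Finset.mem_insertNone.mpr fun S hS => ?_
      exact (isTile_of_symb_eq_some ((hg h h.2).symm.trans hS)).1
    · have hy_sum : ∑ h : {h // h ∈ F}, a * (symbolSize (y h.1) : ℝ) =
          a * ∑ h ∈ F, (symbolSize (𝒯.symb (h * g)) : ℝ) := by
        rw [Finset.sum_coe_sort F fun h => a * (symbolSize (y h) : ℝ), Finset.mul_sum]
        exact Finset.sum_congr rfl fun h hh => by rw [hg h hh]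
      have hle : ∑ h ∈ F, (symbolSize (𝒯.symb (h * g)) : ℝ) ≤
          (1 + η) / (1 - ε) * F.card := by
        rw [div_mul_eq_mul_div, le_div_iff₀ hε', mul_comm]
        exact (h𝒯.sum_symbolSize_le F g).trans hF
      rw [hy_sum, hB, mul_assoc]
      exact mul_le_mul_of_nonneg_left hle ha
  have hcomp : complexity (orbitClosure 𝒯.symb) F ≤ P.card := by
    rw [← Set.ncard_coe_finset]
    exact Set.ncard_le_ncard hsub P.finite_toSet
  have hcount := card_words_weight_le (ι := {h // h ∈ F}) (Finset.insertNone 𝒯.shapes)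
    (fun o => a * (symbolSize o : ℝ)) B
  have halph : ∑ o ∈ Finset.insertNone 𝒯.shapes, (2 : ℝ) ^ (-(a * (symbolSize o : ℝ))) ≤
      2 ^ b := by
    rw [Finset.sum_insertNone]
    simpa [symbolSize] using hsum
  have hbound : (complexity (orbitClosure 𝒯.symb) F : ℝ) ≤ 2 ^ (B + b * F.card) := by
    rw [Real.rpow_add two_pos, Real.rpow_mul two_pos.le b, Real.rpow_natCast]
    refine ((Nat.cast_le.mpr hcomp).trans hcount).trans ?_
    rw [Fintype.card_coe]
    gcongr
  rw [add_mul, ← hB]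
  rcases (Nat.cast_nonneg (α := ℝ) (complexity (orbitClosure 𝒯.symb) F)).eq_or_lt with h0 | h0
  · rw [← h0, Real.logb_zero]
    positivity
  · exact (Real.logb_le_iff_le_rpow one_lt_two h0).mpr hbound

end Quasitiling

/-- for every `r` and `ε > 0` there is `δ > 0` such that every
`(1/4)`-disjoint quasitiling whose shapes split into `r` classes `𝒮 i` with minimal
shape-cardinalities `s i ≥ 1/δ` and `|𝒮 i| ≤ 2^(ε·s i)` has entropy less than `3ε`. -/
theorem statement8 {G : Type*} [Group G] [Countable G] (hG : IsAmenable G)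
    (r : ℕ) (hr : 0 < r) (ε : ℝ) (hε : 0 < ε) :
    ∃ δ : ℝ, 0 < δ ∧
      ∀ (𝒯 : Quasitiling G) (𝒮 : Fin r → Finset (Finset G)) (s : Fin r → ℕ),
        𝒯.EpsDisjoint (1/4) →
        (∀ i, 𝒮 i ⊆ 𝒯.shapes) →
        (∀ S ∈ 𝒯.shapes, ∃ i, S ∈ 𝒮 i) →
        (∀ i j, i ≠ j → Disjoint (𝒮 i) (𝒮 j)) →
        (∀ i, ∃ S ∈ 𝒮 i, S.card = s i) →
        (∀ i, ∀ S ∈ 𝒮 i, s i ≤ S.card) →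
        (∀ i, (1 : ℝ) / δ ≤ (s i : ℝ)) →
        (∀ i, ((𝒮 i).card : ℝ) ≤ (2 : ℝ) ^ (ε * (s i : ℝ))) →
        𝒯.entropy < 3 * ε := by
  have hε' : (1 : ℝ) < 2 ^ ε := Real.one_lt_rpow one_lt_two hε
  have hlim : Tendsto (fun n : ℕ => (r : ℝ) * ((2 : ℝ) ^ (-(ε / 4))) ^ n) atTop (nhds 0) := by
    simpa using (tendsto_pow_atTop_nhds_zero_of_lt_one (by positivity)
      (Real.rpow_lt_one_of_one_lt_of_neg one_lt_two
        (by linarith : -(ε / 4) < 0))).const_mul (r : ℝ)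
  obtain ⟨n, hn, hn0⟩ :=
    ((hlim.eventually (gt_mem_nhds (sub_pos.mpr hε'))).and (eventually_gt_atTop 0)).exists
  refine ⟨1 / n, by positivity, fun 𝒯 𝒮 s hdisj _ hcover hpair _ hmin hs hcard => ?_⟩
  have hclass : ∀ i, ∑ S ∈ 𝒮 i, (2 : ℝ) ^ (-(5 / 4 * ε * S.card)) ≤
      ((2 : ℝ) ^ (-(ε / 4))) ^ n := by
    intro i
    have hsi : (n : ℝ) ≤ s i := by simpa using hs i
    calc ∑ S ∈ 𝒮 i, (2 : ℝ) ^ (-(5 / 4 * ε * S.card))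
        ≤ ∑ S ∈ 𝒮 i, (2 : ℝ) ^ (-(5 / 4 * ε * s i)) := by
          refine Finset.sum_le_sum fun S hS => ?_
          have := hmin i S hS
          gcongr
          norm_num
      _ = (𝒮 i).card * (2 : ℝ) ^ (-(5 / 4 * ε * s i)) := by
          rw [Finset.sum_const, nsmul_eq_mul]
      _ ≤ (2 : ℝ) ^ (ε * s i) * (2 : ℝ) ^ (-(5 / 4 * ε * s i)) := by
          gcongr
          exact hcard i
      _ = (2 : ℝ) ^ (-(ε / 4) * s i) := by
          rw [← Real.rpow_add two_pos]
          ring_nf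
      _ ≤ (2 : ℝ) ^ (-(ε / 4) * n) :=
          Real.rpow_le_rpow_of_exponent_le one_le_two
            (mul_le_mul_of_nonpos_left hsi (by linarith))
      _ = ((2 : ℝ) ^ (-(ε / 4))) ^ n := by
          rw [Real.rpow_mul two_pos.le, Real.rpow_natCast]
  have hsum : 1 + ∑ S ∈ 𝒯.shapes, (2 : ℝ) ^ (-(5 / 4 * ε * S.card)) ≤ 2 ^ ε := by
    have hsub : 𝒯.shapes ⊆ Finset.univ.biUnion 𝒮 := fun S hS =>
      Finset.mem_biUnion.mpr ((hcover S hS).imp fun i hi => ⟨Finset.mem_univ i, hi⟩)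
    have hle : ∑ S ∈ 𝒯.shapes, (2 : ℝ) ^ (-(5 / 4 * ε * S.card)) ≤
        r * ((2 : ℝ) ^ (-(ε / 4))) ^ n :=
      calc ∑ S ∈ 𝒯.shapes, (2 : ℝ) ^ (-(5 / 4 * ε * S.card))
          ≤ ∑ S ∈ Finset.univ.biUnion 𝒮, (2 : ℝ) ^ (-(5 / 4 * ε * S.card)) :=
            Finset.sum_le_sum_of_subset_of_nonneg hsub fun _ _ _ => by positivity
        _ = ∑ i, ∑ S ∈ 𝒮 i, (2 : ℝ) ^ (-(5 / 4 * ε * S.card)) :=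
            Finset.sum_biUnion fun i _ j _ hij => hpair i j hij
        _ ≤ ∑ _i : Fin r, ((2 : ℝ) ^ (-(ε / 4))) ^ n :=
            Finset.sum_le_sum fun i _ => hclass i
        _ = r * ((2 : ℝ) ^ (-(ε / 4))) ^ n := by simp
    linarith
  have h := hdisj.entropy_le hG (by norm_num) (by positivity) hε.le
    (by norm_num : (0 : ℝ) < 1 / 8) hsum
  linarith

end AmenableTilings
end
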